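/- Let p>2, let u be a nonnegative classical solution of u_t−Δu=|∇u|^p in Q_T with u=0 on Γ_T, having an isolated gradient blowup point at (0,0,T) and satisfying the monotonicity condition x·u_x≤0 in Q_T. Then there exist C>0 and ρ>0 such that, with β=1/(p−1), d_p=β^β and c_p=d_p/(1−β): (i) u_y(x,y,t) ≤ [(u_y(x,0,t))^{1−p}+(p−1)y]^{−β}+2Cy for all (x,y)∈ω_ρ=(−ρ,ρ)×(0,ρ) and t∈[T−ρ,T); (ii) u_y(x,y,t) ≤ d_p y^{−β}+2Cy on the same set; (iii) u(x,y,t) ≤ c_p y^{1−β}+Cy² on the same set. -/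

import Mathlib

open Real Set Filter MeasureTheory

noncomputable section

/-- Partial derivative of `u(x,y,t)` with respect to `x`. -/
def pdx (u : ℝ → ℝ → ℝ → ℝ) (x y t : ℝ) : ℝ := deriv (fun s => u s y t) x

/-- Partial derivative with respect to `y`. -/
def pdy (u : ℝ → ℝ → ℝ → ℝ) (x y t : ℝ) : ℝ := deriv (fun s => u x s t) y

/-- Partial derivative with respect to `t`. -/
def pdt (u : ℝ → ℝ → ℝ → ℝ) (x y t : ℝ) : ℝ := deriv (fun s => u x y s) t

/-- Second partial derivative with respect to `x`. -/
def pdxx (u : ℝ → ℝ → ℝ → ℝ) (x y t : ℝ) : ℝ := deriv (fun s => pdx u s y t) x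

/-- Second partial derivative with respect to `y`. -/
def pdyy (u : ℝ → ℝ → ℝ → ℝ) (x y t : ℝ) : ℝ := deriv (fun s => pdy u x s t) y

/-- Mixed second partial derivative `u_{xy}` (first `x`, then `y`). -/
def pdxy (u : ℝ → ℝ → ℝ → ℝ) (x y t : ℝ) : ℝ := deriv (fun s => pdx u x s t) y

/-- The norm of the spatial gradient, `|∇u| = (u_x² + u_y²)^{1/2}`. -/
def gradNorm (u : ℝ → ℝ → ℝ → ℝ) (x y t : ℝ) : ℝ :=
  Real.sqrt ((pdx u x y t) ^ 2 + (pdy u x y t) ^ 2)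

/-- `C^{2,1}`-type regularity of `u` at the point `(x,y,t)`: twice (continuously)
differentiable in the space variables and once in time. -/
def C21At (u : ℝ → ℝ → ℝ → ℝ) (x y t : ℝ) : Prop :=
  DifferentiableAt ℝ (fun s => u s y t) x ∧
  DifferentiableAt ℝ (fun s => u x s t) y ∧
  DifferentiableAt ℝ (fun s => u x y s) t ∧
  DifferentiableAt ℝ (fun s => pdx u s y t) x ∧
  DifferentiableAt ℝ (fun s => pdy u x s t) y ∧
  DifferentiableAt ℝ (fun s => pdx u x s t) y ∧
  ContinuousAt (fun q : ℝ × ℝ × ℝ => u q.1 q.2.1 q.2.2) (x, y, t) ∧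
  ContinuousAt (fun q : ℝ × ℝ × ℝ => pdx u q.1 q.2.1 q.2.2) (x, y, t) ∧
  ContinuousAt (fun q : ℝ × ℝ × ℝ => pdy u q.1 q.2.1 q.2.2) (x, y, t) ∧
  ContinuousAt (fun q : ℝ × ℝ × ℝ => pdt u q.1 q.2.1 q.2.2) (x, y, t) ∧
  ContinuousAt (fun q : ℝ × ℝ × ℝ => pdxx u q.1 q.2.1 q.2.2) (x, y, t) ∧
  ContinuousAt (fun q : ℝ × ℝ × ℝ => pdyy u q.1 q.2.1 q.2.2) (x, y, t) ∧
  ContinuousAt (fun q : ℝ × ℝ × ℝ => pdxy u q.1 q.2.1 q.2.2) (x, y, t)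

/-- `u` is a nonnegative classical solution of `u_t - Δu = |∇u|^p` in
`Q_T = ω × (0,T)`, `ω = (-L,L) × (0,L)`, with `u = 0` on `Γ_T = (-L,L) × {0} × (0,T)`. -/
structure ClassicalSolution (p L T : ℝ) (u : ℝ → ℝ → ℝ → ℝ) : Prop where
  nonneg : ∀ ⦃x y t : ℝ⦄, |x| ≤ L → y ∈ Icc (0:ℝ) L → t ∈ Ioo 0 T → 0 ≤ u x y t
  smooth : ∀ ⦃x y t : ℝ⦄, |x| ≤ L → y ∈ Icc (0:ℝ) L → t ∈ Ioo 0 T → C21At u x y t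
  pde : ∀ ⦃x y t : ℝ⦄, |x| < L → y ∈ Ioo (0:ℝ) L → t ∈ Ioo 0 T →
    pdt u x y t - (pdxx u x y t + pdyy u x y t) = gradNorm u x y t ^ p
  bc : ∀ ⦃x t : ℝ⦄, |x| < L → t ∈ Ioo 0 T → u x 0 t = 0

/-- `u` has an isolated gradient blow-up point at `(0,0,T)`:
`limsup |∇u| = ∞` at `(0,0,T)` while `∇u` stays bounded on `K × (0,T)` for every
compact `K ⊆ ω̄ \ {(0,0)}`. -/
structure IsolatedGBU (L T : ℝ) (u : ℝ → ℝ → ℝ → ℝ) : Prop where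
  blowup : ∀ M : ℝ, ∀ δ > (0:ℝ), ∃ x y t : ℝ, |x| ≤ L ∧ y ∈ Icc (0:ℝ) L ∧
    t ∈ Ioo 0 T ∧ |x| < δ ∧ |y| < δ ∧ T - δ < t ∧ M < gradNorm u x y t
  bounded : ∀ K : Set (ℝ × ℝ), IsCompact K →
    K ⊆ (Icc (-L) L ×ˢ Icc (0:ℝ) L) \ {((0:ℝ), (0:ℝ))} →
    ∃ M : ℝ, ∀ q ∈ K, ∀ t ∈ Ioo (0:ℝ) T, gradNorm u q.1 q.2 t ≤ M

/-- `u` extends as a `C^{2,1}` function to `(ω̄' × [T/2,T]) \ {(0,0,T)}`,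
`ω' = (-L/2,L/2) × (0,L/2)`; values and derivatives at `t = T` refer to this extension. -/
def ExtC21 (L T : ℝ) (u : ℝ → ℝ → ℝ → ℝ) : Prop :=
  ∀ ⦃x y t : ℝ⦄, |x| ≤ L / 2 → y ∈ Icc (0:ℝ) (L / 2) → t ∈ Icc (T / 2) T →
    ¬(x = 0 ∧ y = 0 ∧ t = T) → C21At u x y t

/-- The monotonicity condition `x·u_x ≤ 0` in `Q_T`. -/
def MonCond (L T : ℝ) (u : ℝ → ℝ → ℝ → ℝ) : Prop :=
  ∀ ⦃x y t : ℝ⦄, |x| < L → y ∈ Ioo (0:ℝ) L → t ∈ Ioo 0 T → x * pdx u x y t ≤ 0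

lemma aux_second_le {f f' : ℝ → ℝ} {x c : ℝ}
    (h1 : ∀ᶠ s in nhds x, HasDerivAt f (f' s) s) (h2 : HasDerivAt f' c x)
    (hm : IsLocalMax f x) : f' x = 0 ∧ c ≤ 0 := by
  have h1x := h1.self_of_nhds
  have h0 : f' x = 0 := hm.hasDerivAt_eq_zero h1x
  refine ⟨h0, ?_⟩
  by_contra hc
  push Not at hc
  have hd : deriv f =ᶠ[nhds x] f' := h1.mono fun s hs => hs.deriv
  have hdd : deriv (deriv f) x = c := by
    rw [hd.deriv_eq, h2.deriv]
  have hmin : IsLocalMin f x :=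
    isLocalMin_of_deriv_deriv_pos (by rw [hdd]; exact hc) (by rw [h1x.deriv, h0])
      h1x.continuousAt
  have hconst : f =ᶠ[nhds x] fun _ => f x := by
    filter_upwards [hm, hmin] with s a b
    exact le_antisymm a b
  have : deriv f =ᶠ[nhds x] fun _ => 0 := by
    have := hconst.deriv
    simpa using this
  have h3 : deriv (deriv f) x = 0 := by rw [this.deriv_eq]; simp
  rw [hdd] at h3
  exact absurd h3 hc.ne'

lemma aux_left_deriv {f : ℝ → ℝ} {c t t0 : ℝ} (ht : t0 < t) (h : HasDerivAt f c t)
    (hm : ∀ s, t0 ≤ s → s ≤ t → f s ≤ f t) : 0 ≤ c := by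
  have h1 : HasDerivWithinAt f c (Iio t) t := h.hasDerivWithinAt
  rw [hasDerivWithinAt_iff_tendsto_slope' (by simp)] at h1
  refine ge_of_tendsto h1 ?_
  filter_upwards [Ico_mem_nhdsLT ht] with s hs
  rw [slope_def_field]
  exact div_nonneg_of_nonpos (by linarith [hm s hs.1 hs.2.le]) (by linarith [hs.2])

lemma aux_cvx {p : ℝ} (hp : 2 < p) (a b c d : ℝ) :
    √(a^2+b^2) ^ p + p * √(a^2+b^2) ^ (p-2) * (a * (c-a) + b * (d-b)) ≤ √(c^2+d^2) ^ p := by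
  set r := √(a^2+b^2) with hr
  set q := √(c^2+d^2) with hq
  have hr0 : 0 ≤ r := Real.sqrt_nonneg _
  have hq0 : 0 ≤ q := Real.sqrt_nonneg _
  have hr2 : r^2 = a^2+b^2 := Real.sq_sqrt (by positivity)
  have hq2 : q^2 = c^2+d^2 := Real.sq_sqrt (by positivity)
  have hcs : a*c+b*d ≤ r*q := by
    apply le_of_sq_le_sq _ (by positivity) |> fun h => h
    rw [mul_pow, hr2, hq2]; nlinarith [sq_nonneg (a*d-b*c)]
  rcases hr0.eq_or_lt with h | h
  · rw [← h, Real.zero_rpow (by linarith), Real.zero_rpow (by linarith)]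
    simp; positivity
  have e1 : r^p = r^(p-2) * r^2 := by
    rw [← Real.rpow_natCast, ← Real.rpow_add h]; congr 1; push_cast; ring
  have e2 : r^(p-1) = r^(p-2) * r := by
    rw [← Real.rpow_add_one h.ne']; congr 1; ring
  have hy := Real.young_inequality_of_nonneg (a := q) (b := r^(p-1)) (p := p) (q := p/(p-1)) hq0
    (by positivity) (Real.HolderConjugate.conjExponent (by linarith))
  rw [← Real.rpow_mul hr0, mul_div_cancel₀ _ (by linarith : p-1 ≠ 0)] at hy
  have hy2 : p * (q * r^(p-1)) ≤ q^p + (p-1) * r^p := by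
    have := mul_le_mul_of_nonneg_left hy (by linarith : 0 ≤ p)
    refine this.trans (le_of_eq ?_)
    have : p - 1 ≠ 0 := by linarith
    field_simp
  rw [e2] at hy2
  have h5 : 0 ≤ r^(p-2) := by positivity
  have h6 := mul_le_mul_of_nonneg_left hcs (mul_nonneg (by linarith : 0 ≤ p) h5)
  have h7 : a*(c-a)+b*(d-b) = (a*c+b*d) - r^2 := by rw [hr2]; ring
  rw [h7]
  nlinarith

def DomOK (L T x y t : ℝ) : Prop := |x| ≤ L ∧ y ∈ Icc (0:ℝ) L ∧ t ∈ Ioo 0 T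

lemma aux_unif {L T t0 T2 : ℝ} (ht0 : 0 < t0) (hT2 : T2 < T) (f : ℝ → ℝ → ℝ → ℝ)
    (hf : ∀ x y t, DomOK L T x y t → ContinuousAt (fun q : ℝ × ℝ × ℝ => f q.1 q.2.1 q.2.2) (x,y,t))
    {η : ℝ} (hη : 0 < η) :
    ∃ h0 > 0, ∀ x y t x' y' t', |x| ≤ L → |x'| ≤ L → y ∈ Icc (0:ℝ) L → y' ∈ Icc (0:ℝ) L →
      t ∈ Icc t0 T2 → t' ∈ Icc t0 T2 → |x' - x| < h0 → |y'-y| < h0 → |t'-t| < h0 →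
      |f x' y' t' - f x y t| < η := by
  have hc : IsCompact (Icc (-L) L ×ˢ Icc (0:ℝ) L ×ˢ Icc t0 T2) :=
    isCompact_Icc.prod (isCompact_Icc.prod isCompact_Icc)
  have hcont : ContinuousOn (fun q : ℝ × ℝ × ℝ => f q.1 q.2.1 q.2.2)
      (Icc (-L) L ×ˢ Icc (0:ℝ) L ×ˢ Icc t0 T2) := by
    rintro ⟨x,y,t⟩ ⟨hx,hy,ht⟩
    exact (hf x y t ⟨abs_le.2 hx, hy, lt_of_lt_of_le ht0 ht.1, lt_of_le_of_lt ht.2 hT2⟩).continuousWithinAt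
  have hu := hc.uniformContinuousOn_of_continuous hcont
  rw [Metric.uniformContinuousOn_iff] at hu
  obtain ⟨h0, hh0, H⟩ := hu η hη
  refine ⟨h0, hh0, ?_⟩
  intro x y t x' y' t' hx hx' hy hy' ht ht' a b c
  have := H (x',y',t') ⟨abs_le.1 hx', hy', ht'⟩ (x,y,t) ⟨abs_le.1 hx, hy, ht⟩ (by
    simp only [Prod.dist_eq, Real.dist_eq]; exact max_lt a (max_lt b c))
  simpa [Real.dist_eq] using this

def Dop (h : ℝ) (v : ℝ → ℝ → ℝ → ℝ) (x y t : ℝ) : ℝ :=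
  (v x y (t+h) - v x y t) / h - (v (x+h) y (t+h) + v (x-h) y (t+h) - 2 * v x y (t+h)) / h^2

def Sop (h : ℝ) (v : ℝ → ℝ → ℝ → ℝ) (x y t : ℝ) : ℝ :=
  (v x (y+h) (t+h) - v x y (t+h)) / h

lemma Dop_x {h : ℝ} {v w : ℝ → ℝ → ℝ → ℝ} {x y t : ℝ}
    (H1 : HasDerivAt (fun s => v s y (t+h)) (w x y (t+h)) x)
    (H2 : HasDerivAt (fun s => v s y t) (w x y t) x)
    (H3 : HasDerivAt (fun s => v s y (t+h)) (w (x+h) y (t+h)) (x+h))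
    (H4 : HasDerivAt (fun s => v s y (t+h)) (w (x-h) y (t+h)) (x-h)) :
    HasDerivAt (fun s => Dop h v s y t) (Dop h w x y t) x := by
  unfold Dop
  exact ((H1.sub H2).div_const h).sub
    ((((H3.comp_add_const x h).add (H4.comp_sub_const x h)).sub (H1.const_mul 2)).div_const _)

lemma Dop_y {h : ℝ} {v w : ℝ → ℝ → ℝ → ℝ} {x y t : ℝ}
    (H1 : HasDerivAt (fun s => v x s (t+h)) (w x y (t+h)) y)
    (H2 : HasDerivAt (fun s => v x s t) (w x y t) y)
    (H3 : HasDerivAt (fun s => v (x+h) s (t+h)) (w (x+h) y (t+h)) y)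
    (H4 : HasDerivAt (fun s => v (x-h) s (t+h)) (w (x-h) y (t+h)) y) :
    HasDerivAt (fun s => Dop h v x s t) (Dop h w x y t) y := by
  unfold Dop
  exact ((H1.sub H2).div_const h).sub (((H3.add H4).sub (H1.const_mul 2)).div_const _)

lemma Dop_t {h : ℝ} {v w : ℝ → ℝ → ℝ → ℝ} {x y t : ℝ}
    (H1 : HasDerivAt (fun s => v x y s) (w x y (t+h)) (t+h))
    (H2 : HasDerivAt (fun s => v x y s) (w x y t) t)
    (H3 : HasDerivAt (fun s => v (x+h) y s) (w (x+h) y (t+h)) (t+h))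
    (H4 : HasDerivAt (fun s => v (x-h) y s) (w (x-h) y (t+h)) (t+h)) :
    HasDerivAt (fun s => Dop h v x y s) (Dop h w x y t) t := by
  unfold Dop
  exact (((H1.comp_add_const t h).sub H2).div_const h).sub
    ((((H3.comp_add_const t h).add (H4.comp_add_const t h)).sub
      ((H1.comp_add_const t h).const_mul 2)).div_const _)

lemma Sop_x {h : ℝ} {v w : ℝ → ℝ → ℝ → ℝ} {x y t : ℝ}
    (H1 : HasDerivAt (fun s => v s y (t+h)) (w x y (t+h)) x)
    (H2 : HasDerivAt (fun s => v s (y+h) (t+h)) (w x (y+h) (t+h)) x) :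
    HasDerivAt (fun s => Sop h v s y t) (Sop h w x y t) x := by
  unfold Sop
  exact (H2.sub H1).div_const h

lemma Sop_y {h : ℝ} {v w : ℝ → ℝ → ℝ → ℝ} {x y t : ℝ}
    (H1 : HasDerivAt (fun s => v x s (t+h)) (w x y (t+h)) y)
    (H2 : HasDerivAt (fun s => v x s (t+h)) (w x (y+h) (t+h)) (y+h)) :
    HasDerivAt (fun s => Sop h v x s t) (Sop h w x y t) y := by
  unfold Sop
  exact ((H2.comp_add_const y h).sub H1).div_const h

lemma Sop_t {h : ℝ} {v w : ℝ → ℝ → ℝ → ℝ} {x y t : ℝ}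
    (H1 : HasDerivAt (fun s => v x y s) (w x y (t+h)) (t+h))
    (H2 : HasDerivAt (fun s => v x (y+h) s) (w x (y+h) (t+h)) (t+h)) :
    HasDerivAt (fun s => Sop h v x y s) (Sop h w x y t) t := by
  unfold Sop
  exact ((H2.comp_add_const t h).sub (H1.comp_add_const t h)).div_const h

section sol
variable {p L T : ℝ} {u : ℝ → ℝ → ℝ → ℝ}

lemma sol_x (hs : ClassicalSolution p L T u) {x y t : ℝ} (hg : DomOK L T x y t) :
    HasDerivAt (fun s => u s y t) (pdx u x y t) x := (hs.smooth hg.1 hg.2.1 hg.2.2).1.hasDerivAt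
lemma sol_y (hs : ClassicalSolution p L T u) {x y t : ℝ} (hg : DomOK L T x y t) :
    HasDerivAt (fun s => u x s t) (pdy u x y t) y := (hs.smooth hg.1 hg.2.1 hg.2.2).2.1.hasDerivAt
lemma sol_t (hs : ClassicalSolution p L T u) {x y t : ℝ} (hg : DomOK L T x y t) :
    HasDerivAt (fun s => u x y s) (pdt u x y t) t := (hs.smooth hg.1 hg.2.1 hg.2.2).2.2.1.hasDerivAt
lemma sol_xx (hs : ClassicalSolution p L T u) {x y t : ℝ} (hg : DomOK L T x y t) :
    HasDerivAt (fun s => pdx u s y t) (pdxx u x y t) x :=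
  (hs.smooth hg.1 hg.2.1 hg.2.2).2.2.2.1.hasDerivAt
lemma sol_yy (hs : ClassicalSolution p L T u) {x y t : ℝ} (hg : DomOK L T x y t) :
    HasDerivAt (fun s => pdy u x s t) (pdyy u x y t) y :=
  (hs.smooth hg.1 hg.2.1 hg.2.2).2.2.2.2.1.hasDerivAt

/-- finite difference as derivative values -/
lemma Dop_mvt (hs : ClassicalSolution p L T u) {h x y t : ℝ} (hh : 0 < h) (hx : |x| + h ≤ L)
    (hy : y ∈ Icc (0:ℝ) L) (ht : 0 < t) (hT : t + h < T) :
    ∃ τ ξ, τ ∈ Icc t (t+h) ∧ |ξ - x| ≤ h ∧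
      Dop h u x y t = pdt u x y τ - pdxx u ξ y (t+h) := by
  have hxx := abs_le.1 (show |x| ≤ L - h by linarith)
  have hG : ∀ s, |s - x| ≤ h → DomOK L T s y (t+h) := fun s hs' => by
    have := abs_le.1 hs'
    exact ⟨abs_le.2 ⟨by linarith, by linarith⟩, hy, by linarith, hT⟩
  have hGt : ∀ s ∈ Icc t (t+h), DomOK L T x y s := fun s hs' =>
    ⟨by linarith, hy, by linarith [hs'.1], by linarith [hs'.2]⟩
  obtain ⟨τ, hτ, e1⟩ := exists_hasDerivAt_eq_slope (fun s => u x y s) (fun s => pdt u x y s)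
    (show t < t + h by linarith)
    (fun s hs' => (sol_t hs (hGt s hs')).continuousAt.continuousWithinAt)
    (fun s hs' => sol_t hs (hGt s (Ioo_subset_Icc_self hs')))
  have d1 : ∀ s, |s| ≤ h → HasDerivAt (fun s => u (x+s) y (t+h) + u (x-s) y (t+h) - 2 * u x y (t+h))
      (pdx u (x+s) y (t+h) - pdx u (x-s) y (t+h)) s := by
    intro s hs'
    have a := (sol_x hs (hG (x+s) (by simpa using hs'))).comp_const_add x s
    have b := (sol_x hs (hG (x-s) (by simpa using hs'))).comp_const_sub x s
    simpa [sub_eq_add_neg] using (a.add b).sub_const (2 * u x y (t+h))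
  obtain ⟨θ, hθ, e2⟩ := exists_ratio_hasDerivAt_eq_ratio_slope
    (fun s => u (x+s) y (t+h) + u (x-s) y (t+h) - 2 * u x y (t+h))
    (fun s => pdx u (x+s) y (t+h) - pdx u (x-s) y (t+h)) hh
    (fun s hs' => (d1 s (abs_le.2 ⟨by linarith [hs'.1], hs'.2⟩)).continuousAt.continuousWithinAt)
    (fun s hs' => d1 s (abs_le.2 ⟨by linarith [hs'.1], hs'.2.le⟩))
    (fun s => s^2) (fun s => 2 * s) (by fun_prop)
    (fun s _ => by simpa using hasDerivAt_pow 2 s)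
  obtain ⟨ξ, hξ, e3⟩ := exists_hasDerivAt_eq_slope (fun s => pdx u s y (t+h))
    (fun s => pdxx u s y (t+h))
    (show x - θ < x + θ by linarith [hθ.1])
    (fun s hs' => (sol_xx hs (hG s (abs_le.2 ⟨by linarith [hs'.1, hθ.2], by linarith [hs'.2, hθ.2]⟩))).continuousAt.continuousWithinAt)
    (fun s hs' => sol_xx hs (hG s (abs_le.2 ⟨by linarith [hs'.1, hθ.2], by linarith [hs'.2, hθ.2]⟩)))
  refine ⟨τ, ξ, Ioo_subset_Icc_self hτ,
    abs_le.2 ⟨by linarith [hξ.1, hθ.2], by linarith [hξ.2, hθ.2]⟩, ?_⟩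
  unfold Dop
  rw [e1, e3]
  have hθ0 := hθ.1
  simp only [add_zero, sub_zero] at e2
  have : pdx u (x+θ) y (t+h) - pdx u (x-θ) y (t+h) =
    (u (x+h) y (t+h) + u (x-h) y (t+h) - 2 * u x y (t+h)) / h^2 * (2*θ) := by
    field_simp
    linear_combination e2
  rw [this]
  have h1 : t + h - t = h := by ring
  have h2 : x + θ - (x - θ) = 2 * θ := by ring
  rw [h1, h2]
  field_simp

lemma Dop_unif (hs : ClassicalSolution p L T u) {t0 T1 : ℝ} (hL : 0 < L) (ht0 : 0 < t0) (hT1 : T1 < T)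
    {η : ℝ} (hη : 0 < η) :
    ∃ h0 > 0, ∀ h, 0 < h → h < h0 → t0 ≤ T1 → T1 + h < T ∧ ∀ x y t, |x| ≤ L/2 → y ∈ Icc (0:ℝ) L →
      t ∈ Icc t0 T1 → |Dop h u x y t - (pdt u x y t - pdxx u x y t)| < η := by
  obtain ⟨a, ha, Ha⟩ := aux_unif (L := L) (T := T) (t0 := t0) (T2 := (T1+T)/2) ht0 (by linarith)
    (pdt u) (fun x y t hg => (hs.smooth hg.1 hg.2.1 hg.2.2).2.2.2.2.2.2.2.2.2.1) (half_pos hη)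
  obtain ⟨b, hb, Hb⟩ := aux_unif (L := L) (T := T) (t0 := t0) (T2 := (T1+T)/2) ht0 (by linarith)
    (pdxx u) (fun x y t hg => (hs.smooth hg.1 hg.2.1 hg.2.2).2.2.2.2.2.2.2.2.2.2.1) (half_pos hη)
  refine ⟨min (min a b) (min (L/2) ((T-T1)/2)), by
    have : 0 < T - T1 := by linarith
    positivity, ?_⟩
  intro h hh hlt h01
  simp only [lt_min_iff] at hlt
  obtain ⟨⟨hla, hlb⟩, hlL, hlT⟩ := hlt
  refine ⟨by linarith, ?_⟩
  intro x y t hx hy ht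
  obtain ⟨τ, ξ, hτ, hξ, e⟩ := Dop_mvt hs hh (show |x| + h ≤ L by linarith) hy
    (lt_of_lt_of_le ht0 ht.1) (by linarith [ht.2])
  have h3 := abs_le.1 hξ
  have h4 := abs_le.1 hx
  have A := Ha x y t x y τ (by linarith) (by linarith) hy hy ⟨ht.1, by linarith [ht.2]⟩
    ⟨by linarith [ht.1, hτ.1], by linarith [hτ.2, ht.2]⟩ (by simpa using ha) (by simpa using ha)
    (by rw [abs_lt]; constructor <;> linarith [hτ.1, hτ.2])
  have B := Hb x y t ξ y (t+h) (by linarith) (abs_le.2 ⟨by linarith, by linarith⟩) hy hy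
    ⟨ht.1, by linarith [ht.2]⟩
    ⟨by linarith [ht.1], by linarith [ht.2]⟩ (by linarith) (by simpa using hb)
    (by rw [abs_lt]; constructor <;> linarith)
  rw [e]
  rw [abs_lt] at A B ⊢
  constructor <;> linarith [A.1, A.2, B.1, B.2]

/-- components of `H'(∇u)` -/
def Pc (p : ℝ) (v : ℝ → ℝ → ℝ → ℝ) (u : ℝ → ℝ → ℝ → ℝ) (x y t : ℝ) : ℝ :=
  p * gradNorm u x y t ^ (p-2) * v x y t

lemma cvx_u (hp : 2 < p) (u : ℝ → ℝ → ℝ → ℝ) (x y t x' y' t' : ℝ) :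
    gradNorm u x y t ^ p + Pc p (pdx u) u x y t * (pdx u x' y' t' - pdx u x y t)
      + Pc p (pdy u) u x y t * (pdy u x' y' t' - pdy u x y t) ≤ gradNorm u x' y' t' ^ p := by
  have := aux_cvx hp (pdx u x y t) (pdy u x y t) (pdx u x' y' t') (pdy u x' y' t')
  unfold Pc gradNorm
  refine le_trans (le_of_eq ?_) this
  ring

lemma Dop_sub (hp : 2 < p) (hs : ClassicalSolution p L T u) {h x y t : ℝ} (hh : 0 < h)
    (hx : |x| + h < L) (hy : y ∈ Ioo (0:ℝ) L) (ht : 0 < t) (hT : t + h < T) :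
    Dop h (pdt u) x y t - (Dop h (pdxx u) x y t + Dop h (pdyy u) x y t) ≤
      Pc p (pdx u) u x y (t+h) * Dop h (pdx u) x y t
      + Pc p (pdy u) u x y (t+h) * Dop h (pdy u) x y t := by
  have hxx := abs_lt.1 (show |x| < L - h by linarith)
  have e1 := hs.pde (x := x) (y := y) (t := t+h) (by linarith) hy ⟨by linarith, hT⟩
  have e2 := hs.pde (x := x) (y := y) (t := t) (by linarith) hy ⟨by linarith, by linarith⟩
  have e3 := hs.pde (x := x+h) (y := y) (t := t+h) (abs_lt.2 ⟨by linarith, by linarith⟩) hy ⟨by linarith, hT⟩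
  have e4 := hs.pde (x := x-h) (y := y) (t := t+h) (abs_lt.2 ⟨by linarith, by linarith⟩) hy ⟨by linarith, hT⟩
  have c2 := cvx_u hp u x y (t+h) x y t
  have c3 := cvx_u hp u x y (t+h) (x+h) y (t+h)
  have c4 := cvx_u hp u x y (t+h) (x-h) y (t+h)
  rw [← e1, ← e2] at c2
  rw [← e1, ← e3] at c3
  rw [← e1, ← e4] at c4
  have k2 := mul_le_mul_of_nonneg_left c2 (show 0 ≤ h⁻¹ by positivity)
  have k3 := mul_le_mul_of_nonneg_left (add_le_add c3 c4) (show 0 ≤ (h^2)⁻¹ by positivity)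
  unfold Dop
  set P := Pc p (pdx u) u x y (t+h)
  set Q := Pc p (pdy u) u x y (t+h)
  simp only [div_eq_mul_inv]
  generalize (h^2)⁻¹ = m at *
  generalize h⁻¹ = n at *
  linarith

lemma Sop_sub (hp : 2 < p) (hs : ClassicalSolution p L T u) {h x y t : ℝ} (hh : 0 < h)
    (hx : |x| < L) (hy0 : 0 < y) (hy : y + h < L) (ht : 0 < t) (hT : t + h < T) :
    0 ≤ Sop h (pdt u) x y t - (Sop h (pdxx u) x y t + Sop h (pdyy u) x y t)
      - Pc p (pdx u) u x y (t+h) * Sop h (pdx u) x y t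
      - Pc p (pdy u) u x y (t+h) * Sop h (pdy u) x y t ∧
    Sop h (pdt u) x y t - (Sop h (pdxx u) x y t + Sop h (pdyy u) x y t)
      - Pc p (pdx u) u x y (t+h) * Sop h (pdx u) x y t
      - Pc p (pdy u) u x y (t+h) * Sop h (pdy u) x y t ≤
      (Pc p (pdx u) u x (y+h) (t+h) - Pc p (pdx u) u x y (t+h)) * Sop h (pdx u) x y t +
      (Pc p (pdy u) u x (y+h) (t+h) - Pc p (pdy u) u x y (t+h)) * Sop h (pdy u) x y t := by
  have e1 := hs.pde (x := x) (y := y) (t := t+h) hx ⟨hy0, by linarith⟩ ⟨by linarith, hT⟩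
  have e2 := hs.pde (x := x) (y := y+h) (t := t+h) hx ⟨by linarith, hy⟩ ⟨by linarith, by linarith⟩
  have c1 := cvx_u hp u x y (t+h) x (y+h) (t+h)
  have c2 := cvx_u hp u x (y+h) (t+h) x y (t+h)
  rw [← e1, ← e2] at c1 c2
  have k1 := mul_le_mul_of_nonneg_left c1 (show 0 ≤ h⁻¹ by positivity)
  have k2 := mul_le_mul_of_nonneg_left c2 (show 0 ≤ h⁻¹ by positivity)
  unfold Sop
  set P := Pc p (pdx u) u x y (t+h)
  set Q := Pc p (pdy u) u x y (t+h)
  set P' := Pc p (pdx u) u x (y+h) (t+h)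
  set Q' := Pc p (pdy u) u x (y+h) (t+h)
  simp only [div_eq_mul_inv]
  generalize h⁻¹ = n at *
  constructor
  · linarith
  · linarith

lemma cont_shift {v : ℝ → ℝ → ℝ → ℝ} {x y t a b c : ℝ}
    (h : ContinuousAt (fun q : ℝ × ℝ × ℝ => v q.1 q.2.1 q.2.2) (x+a, y+b, t+c)) :
    ContinuousAt (fun q : ℝ × ℝ × ℝ => v (q.1+a) (q.2.1+b) (q.2.2+c)) (x,y,t) := by
  have h2 : ContinuousAt (fun q : ℝ × ℝ × ℝ => ((q.1+a, q.2.1+b, q.2.2+c) : ℝ × ℝ × ℝ)) (x,y,t) := by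
    fun_prop
  exact ContinuousAt.comp (f := fun q : ℝ × ℝ × ℝ => ((q.1+a, q.2.1+b, q.2.2+c) : ℝ × ℝ × ℝ))
    (g := fun q : ℝ × ℝ × ℝ => v q.1 q.2.1 q.2.2) h h2

lemma sol_cont (hs : ClassicalSolution p L T u) {x y t : ℝ} (hg : DomOK L T x y t) :
    ContinuousAt (fun q : ℝ × ℝ × ℝ => u q.1 q.2.1 q.2.2) (x,y,t) :=
  (hs.smooth hg.1 hg.2.1 hg.2.2).2.2.2.2.2.2.1

lemma Dop_cont (hs : ClassicalSolution p L T u) {h x y t : ℝ} (hh : 0 < h)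
    (hx : |x| + h ≤ L) (hy : y ∈ Icc (0:ℝ) L) (ht : 0 < t) (hT : t + h < T) :
    ContinuousAt (fun q : ℝ × ℝ × ℝ => Dop h u q.1 q.2.1 q.2.2) (x,y,t) := by
  have hxx := abs_le.1 (show |x| ≤ L - h by linarith)
  have a1 := cont_shift (a := 0) (b := 0) (c := h) (sol_cont hs (x := x+0) (y := y+0) (t := t+h)
    ⟨by simp; linarith, by simpa using hy, by linarith, hT⟩)
  have a2 := cont_shift (a := 0) (b := 0) (c := 0) (sol_cont hs (x := x+0) (y := y+0) (t := t+0)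
    ⟨by simp; linarith, by simpa using hy, by linarith, by linarith⟩)
  have a3 := cont_shift (a := h) (b := 0) (c := h) (sol_cont hs (x := x+h) (y := y+0) (t := t+h)
    ⟨abs_le.2 ⟨by linarith, by linarith⟩, by simpa using hy, by linarith, hT⟩)
  have a4 := cont_shift (a := -h) (b := 0) (c := h) (sol_cont hs (x := x+-h) (y := y+0) (t := t+h)
    ⟨abs_le.2 ⟨by linarith, by linarith⟩, by simpa using hy, by linarith, hT⟩)
  simp only [add_zero, ← sub_eq_add_neg] at a1 a2 a3 a4
  unfold Dop
  exact ((a1.sub a2).div_const h).sub (((a3.add a4).sub (a1.const_mul 2)).div_const _)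

lemma Sop_cont (hs : ClassicalSolution p L T u) {h x y t : ℝ} (hh : 0 < h)
    (hx : |x| ≤ L) (hy0 : 0 ≤ y) (hy : y + h ≤ L) (ht : 0 < t) (hT : t + h < T) :
    ContinuousAt (fun q : ℝ × ℝ × ℝ => Sop h u q.1 q.2.1 q.2.2) (x,y,t) := by
  have a1 := cont_shift (a := 0) (b := 0) (c := h) (sol_cont hs (x := x+0) (y := y+0) (t := t+h)
    ⟨by simpa using hx, by simp; constructor <;> linarith, by linarith, hT⟩)
  have a2 := cont_shift (a := 0) (b := h) (c := h) (sol_cont hs (x := x+0) (y := y+h) (t := t+h)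
    ⟨by simpa using hx, ⟨by linarith, hy⟩, by linarith, by linarith⟩)
  simp only [add_zero] at a1 a2
  unfold Sop
  exact (a2.sub a1).div_const h

lemma Dop_zero (hs : ClassicalSolution p L T u) {h x t : ℝ} (hh : 0 < h)
    (hx : |x| + h < L) (ht : 0 < t) (hT : t + h < T) : Dop h u x 0 t = 0 := by
  have hxx := abs_lt.1 (show |x| < L - h by linarith)
  have hX : |x| < L := by linarith
  unfold Dop
  rw [hs.bc hX ⟨by linarith, hT⟩, hs.bc hX ⟨ht, by linarith⟩,
    hs.bc (x := x+h) (abs_lt.2 ⟨by linarith, by linarith⟩) ⟨by linarith, hT⟩,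
    hs.bc (x := x-h) (abs_lt.2 ⟨by linarith, by linarith⟩) ⟨by linarith, hT⟩]
  simp

lemma pdy_le_grad (u : ℝ → ℝ → ℝ → ℝ) (x y t : ℝ) : |pdy u x y t| ≤ gradNorm u x y t := by
  unfold gradNorm
  exact Real.abs_le_sqrt (by nlinarith [sq_nonneg (pdx u x y t)])

lemma pdx_le_grad (u : ℝ → ℝ → ℝ → ℝ) (x y t : ℝ) : |pdx u x y t| ≤ gradNorm u x y t := by
  unfold gradNorm
  exact Real.abs_le_sqrt (by nlinarith [sq_nonneg (pdy u x y t)])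

lemma grad_nonneg (u : ℝ → ℝ → ℝ → ℝ) (x y t : ℝ) : 0 ≤ gradNorm u x y t := Real.sqrt_nonneg _

lemma Pc_bound (hp : 2 < p) {v : ℝ → ℝ → ℝ → ℝ} {x y t M : ℝ}
    (h1 : |v x y t| ≤ gradNorm u x y t) (h2 : gradNorm u x y t ≤ M) :
    |Pc p v u x y t| ≤ p * M^(p-2) * M := by
  have h0 := grad_nonneg u x y t
  unfold Pc
  rw [abs_mul, abs_of_nonneg (by positivity)]
  have := Real.rpow_le_rpow h0 h2 (by linarith : 0 ≤ p-2)
  have hM : 0 ≤ M := h0.trans h2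
  exact mul_le_mul (mul_le_mul_of_nonneg_left this (by linarith)) (h1.trans h2) (abs_nonneg _)
    (by positivity)

lemma Pc_cont (hp : 2 < p) {v : ℝ → ℝ → ℝ → ℝ} (hs : ClassicalSolution p L T u) {x y t : ℝ}
    (hg : DomOK L T x y t)
    (hv : ContinuousAt (fun q : ℝ × ℝ × ℝ => v q.1 q.2.1 q.2.2) (x,y,t)) :
    ContinuousAt (fun q : ℝ × ℝ × ℝ => Pc p v u q.1 q.2.1 q.2.2) (x,y,t) := by
  obtain ⟨-,-,-,-,-,-,-,hx,hy,-⟩ := hs.smooth hg.1 hg.2.1 hg.2.2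
  unfold Pc
  refine ContinuousAt.mul (ContinuousAt.mul continuousAt_const ?_) hv
  refine ContinuousAt.rpow_const ?_ (Or.inr (by linarith))
  unfold gradNorm
  exact ((hx.pow 2).add (hy.pow 2)).sqrt

lemma K_slice {A a c s : ℝ} (hg : c - (s-a)^2 ≠ 0) :
    HasDerivAt (fun s => A / (c - (s-a)^2)^2) (4*A*(s-a)/(c-(s-a)^2)^3) s := by
  have h1 : HasDerivAt (fun s => c - (s-a)^2) (-(2*(s-a))) s := by
    have := (((hasDerivAt_id s).sub_const a).pow 2).const_sub c
    simpa using this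
  have h2 := (h1.pow 2).inv (pow_ne_zero 2 hg)
  have h3 := h2.const_mul A
  simp only [div_eq_mul_inv]
  refine HasDerivAt.congr_deriv h3 ?_
  simp only [Pi.pow_apply]
  field_simp
  ring

lemma K_slice2 {A a c s : ℝ} (hg : c - (s-a)^2 ≠ 0) :
    HasDerivAt (fun s => 4*A*(s-a)/(c-(s-a)^2)^3)
      (4*A/(c-(s-a)^2)^3 + 24*A*(s-a)^2/(c-(s-a)^2)^4) s := by
  have h1 : HasDerivAt (fun s => c - (s-a)^2) (-(2*(s-a))) s := by
    have := (((hasDerivAt_id s).sub_const a).pow 2).const_sub c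
    simpa using this
  have h0 : HasDerivAt (fun s => 4*A*(s-a)) (4*A) s := by
    simpa using ((hasDerivAt_id s).sub_const a).const_mul (4*A)
  have h2 := h0.div (h1.pow 3) (pow_ne_zero 3 hg)
  refine HasDerivAt.congr_deriv h2 ?_
  simp only [Pi.pow_apply]
  field_simp
  ring

/-- slices of `E + δ²` -/
lemma W_deriv1 {E D : ℝ → ℝ} {E' D' s : ℝ} (h1 : HasDerivAt E E' s) (h2 : HasDerivAt D D' s) :
    HasDerivAt (fun s => E s + D s ^ 2) (E' + 2 * D s * D') s := by
  refine HasDerivAt.congr_deriv (h1.add (h2.pow 2)) ?_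
  simp

lemma W_deriv2 {E' D D' : ℝ → ℝ} {E'' D'' s : ℝ} (h1 : HasDerivAt E' E'' s)
    (h2 : HasDerivAt D (D' s) s) (h3 : HasDerivAt D' D'' s) :
    HasDerivAt (fun s => E' s + 2 * D s * D' s) (E'' + 2 * (D' s)^2 + 2 * D s * D'') s := by
  refine HasDerivAt.congr_deriv (h1.add ((h2.const_mul 2).mul h3)) ?_
  ring

lemma core_alg {Et Exx Eyy Ex Ey δ δt δx δy δxx δyy Kx Ky Kxx Kyy P Q a b M : ℝ}
    (hM : |δ| ≤ M)
    (h1 : Et - (Exx + Eyy) ≤ P * Ex + Q * Ey)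
    (h20 : 0 ≤ δt - (δxx+δyy) - P*δx - Q*δy)
    (h2 : δt - (δxx+δyy) - P*δx - Q*δy ≤ a*δx+b*δy)
    (ha : |a| < 1/(2*M+1)) (hb : |b| < 1/(2*M+1))
    (ht : 0 ≤ Et + 2*δ*δt)
    (hx : Ex + 2*δ*δx - Kx = 0) (hy : Ey + 2*δ*δy - Ky = 0)
    (hxx : Exx + 2*δx^2+2*δ*δxx - Kxx ≤ 0) (hyy : Eyy + 2*δy^2+2*δ*δyy - Kyy ≤ 0) :
    δx^2+δy^2 ≤ P*Kx+Q*Ky+Kxx+Kyy+1 := by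
  have hM0 : 0 ≤ M := (abs_nonneg _).trans hM
  set Z := δt - (δxx+δyy) - P*δx - Q*δy with hZ
  have hab : ∀ c d : ℝ, |c| < 1/(2*M+1) → 2*M*(c*d) ≤ d^2 + 1/2 := by
    intro c d hc
    rw [lt_div_iff₀ (by positivity)] at hc
    have h3 : 2*M*|c| ≤ 1 := by nlinarith [abs_nonneg c]
    have h4 : 2*M*(c*d) ≤ 2*M*|c| * |d| := by
      rw [mul_assoc (2*M), ← abs_mul]
      exact mul_le_mul_of_nonneg_left (le_abs_self _) (by positivity)
    have h5 : 2*M*|c| * |d| ≤ |d| := by nlinarith [abs_nonneg d]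
    have := sq_abs d
    nlinarith [sq_nonneg (|d| - 1/2)]
  have hδZ : 2*δ*Z ≤ 2*M*(a*δx+b*δy) := by
    have h3 : δ * Z ≤ M * Z := mul_le_mul_of_nonneg_right ((le_abs_self _).trans hM) h20
    have h4 := mul_le_mul_of_nonneg_left h2 hM0
    linarith
  have k1 := hab a δx ha
  have k2 := hab b δy hb
  have e1 : Ex = Kx - 2*δ*δx := by linarith
  have e2 : Ey = Ky - 2*δ*δy := by linarith
  have e3 : δt = Z + (δxx+δyy) + P*δx + Q*δy := by rw [hZ]; ring
  rw [e1, e2] at h1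
  rw [e3] at ht
  nlinarith

/-- all points used by `Dop` are fine -/
lemma Dop_pts {h x y t : ℝ} (hh : 0 < h)
    (hx : |x| + h ≤ L) (hy : y ∈ Icc (0:ℝ) L) (ht : 0 < t) (hT : t + h < T) :
    DomOK L T x y (t+h) ∧ DomOK L T x y t ∧ DomOK L T (x+h) y (t+h) ∧ DomOK L T (x-h) y (t+h) := by
  have hxx := abs_le.1 (show |x| ≤ L - h by linarith)
  exact ⟨⟨by linarith, hy, by linarith, hT⟩, ⟨by linarith, hy, by linarith, by linarith⟩,
    ⟨abs_le.2 ⟨by linarith, by linarith⟩, hy, by linarith, hT⟩,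
    ⟨abs_le.2 ⟨by linarith, by linarith⟩, hy, by linarith, hT⟩⟩

lemma Dop_all (hs : ClassicalSolution p L T u) {h x y t : ℝ} (hh : 0 < h)
    (hx : |x| + h ≤ L) (hy : y ∈ Icc (0:ℝ) L) (ht : 0 < t) (hT : t + h < T) :
    HasDerivAt (fun s => Dop h u s y t) (Dop h (pdx u) x y t) x ∧
    HasDerivAt (fun s => Dop h (pdx u) s y t) (Dop h (pdxx u) x y t) x ∧
    HasDerivAt (fun s => Dop h u x s t) (Dop h (pdy u) x y t) y ∧
    HasDerivAt (fun s => Dop h (pdy u) x s t) (Dop h (pdyy u) x y t) y ∧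
    HasDerivAt (fun s => Dop h u x y s) (Dop h (pdt u) x y t) t := by
  obtain ⟨a,b,c,d⟩ := Dop_pts hh hx hy ht hT
  exact ⟨Dop_x (sol_x hs a) (sol_x hs b) (sol_x hs c) (sol_x hs d),
    Dop_x (sol_xx hs a) (sol_xx hs b) (sol_xx hs c) (sol_xx hs d),
    Dop_y (sol_y hs a) (sol_y hs b) (sol_y hs c) (sol_y hs d),
    Dop_y (sol_yy hs a) (sol_yy hs b) (sol_yy hs c) (sol_yy hs d),
    Dop_t (sol_t hs a) (sol_t hs b) (sol_t hs c) (sol_t hs d)⟩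

lemma Sop_all (hs : ClassicalSolution p L T u) {h x y t : ℝ} (hh : 0 < h)
    (hx : |x| ≤ L) (hy0 : 0 ≤ y) (hy : y + h ≤ L) (ht : 0 < t) (hT : t + h < T) :
    HasDerivAt (fun s => Sop h u s y t) (Sop h (pdx u) x y t) x ∧
    HasDerivAt (fun s => Sop h (pdx u) s y t) (Sop h (pdxx u) x y t) x ∧
    HasDerivAt (fun s => Sop h u x s t) (Sop h (pdy u) x y t) y ∧
    HasDerivAt (fun s => Sop h (pdy u) x s t) (Sop h (pdyy u) x y t) y ∧
    HasDerivAt (fun s => Sop h u x y s) (Sop h (pdt u) x y t) t := by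
  have a : DomOK L T x y (t+h) := ⟨hx, ⟨hy0, by linarith⟩, by linarith, hT⟩
  have b : DomOK L T x (y+h) (t+h) := ⟨hx, ⟨by linarith, hy⟩, by linarith, hT⟩
  exact ⟨Sop_x (sol_x hs a) (sol_x hs b), Sop_x (sol_xx hs a) (sol_xx hs b),
    Sop_y (sol_y hs a) (sol_y hs b), Sop_y (sol_yy hs a) (sol_yy hs b),
    Sop_t (sol_t hs a) (sol_t hs b)⟩

lemma Sop_mvt (hs : ClassicalSolution p L T u) {h x y t : ℝ} (hh : 0 < h)
    (hx : |x| ≤ L) (hy0 : 0 ≤ y) (hy : y + h ≤ L) (ht : 0 < t) (hT : t + h < T) :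
    (∃ ξ ∈ Ioo y (y+h), Sop h u x y t = pdy u x ξ (t+h)) ∧
    (∃ ξ ∈ Ioo y (y+h), Sop h (pdy u) x y t = pdyy u x ξ (t+h)) := by
  have hG : ∀ s ∈ Icc y (y+h), DomOK L T x s (t+h) := fun s hs' =>
    ⟨hx, ⟨by linarith [hs'.1], by linarith [hs'.2]⟩, by linarith, hT⟩
  constructor
  · obtain ⟨τ, hτ, e1⟩ := exists_hasDerivAt_eq_slope (fun s => u x s (t+h)) (fun s => pdy u x s (t+h))
      (show y < y + h by linarith)
      (fun s hs' => (sol_y hs (hG s hs')).continuousAt.continuousWithinAt)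
      (fun s hs' => sol_y hs (hG s (Ioo_subset_Icc_self hs')))
    refine ⟨τ, hτ, ?_⟩
    rw [e1, add_sub_cancel_left]; rfl
  · obtain ⟨τ, hτ, e1⟩ := exists_hasDerivAt_eq_slope (fun s => pdy u x s (t+h))
      (fun s => pdyy u x s (t+h))
      (show y < y + h by linarith)
      (fun s hs' => (sol_yy hs (hG s hs')).continuousAt.continuousWithinAt)
      (fun s hs' => sol_yy hs (hG s (Ioo_subset_Icc_self hs')))
    refine ⟨τ, hτ, ?_⟩
    rw [e1, add_sub_cancel_left]; rfl

/-- final algebra in the local estimate -/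
lemma loc_alg {A g X Y P Q m ρ δx δy N : ℝ} (hρ : 0 < ρ) (hg : 0 < g) (hgd : g = ρ^2 - X^2 - Y^2)
    (hP : |P| ≤ m) (hQ : |Q| ≤ m) (hA1 : 1 ≤ A) (hA2 : 4*(8*m*ρ^3+32*ρ^2)+4*ρ^8 < A)
    (hA3 : 2*N*ρ^4 ≤ A) (hN : 0 ≤ N)
    (hK : A / g^2 ≤ δy + N)
    (hc : δx^2+δy^2 ≤ P*(4*A*X/g^3) + Q*(4*A*Y/g^3) + (4*A/g^3 + 24*A*X^2/g^4)
      + (4*A/g^3 + 24*A*Y^2/g^4) + 1) : False := by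
  have hm : 0 ≤ m := (abs_nonneg _).trans hP
  have hgρ : g ≤ ρ^2 := by rw [hgd]; nlinarith [sq_nonneg X, sq_nonneg Y]
  have hg2 : g^2 ≤ ρ^4 := by
    calc g^2 ≤ (ρ^2)^2 := by gcongr
      _ = ρ^4 := by ring
  have hg4 : g^4 ≤ ρ^8 := by
    calc g^4 ≤ (ρ^2)^4 := by gcongr
      _ = ρ^8 := by ring
  have hNK : 2*N ≤ A/g^2 := by
    rw [le_div_iff₀ (by positivity)]
    nlinarith
  have hδ : A/g^2/2 ≤ δy := by linarith
  have hδ2 : (A/g^2/2)^2 ≤ δy^2 := by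
    have : 0 ≤ A/g^2/2 := by positivity
    gcongr
  have h1 : (A/g^2/2)^2 ≤ P*(4*A*X/g^3) + Q*(4*A*Y/g^3) + (4*A/g^3 + 24*A*X^2/g^4)
      + (4*A/g^3 + 24*A*Y^2/g^4) + 1 := by linarith [sq_nonneg δx]
  have h2 := mul_le_mul_of_nonneg_right h1 (show 0 ≤ g^4 by positivity)
  have h3 : (A/g^2/2)^2 * g^4 = A^2/4 := by field_simp; norm_num
  have h4 : (P*(4*A*X/g^3) + Q*(4*A*Y/g^3) + (4*A/g^3 + 24*A*X^2/g^4)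
      + (4*A/g^3 + 24*A*Y^2/g^4) + 1) * g^4 =
      A * (4*g*(P*X+Q*Y) + 8*g + 24*(X^2+Y^2)) + g^4 := by
    field_simp; ring
  rw [h3, h4] at h2
  have hX : |X| ≤ ρ := abs_le_of_sq_le_sq (by linarith [sq_nonneg Y]) hρ.le
  have hY : |Y| ≤ ρ := abs_le_of_sq_le_sq (by linarith [sq_nonneg X]) hρ.le
  have hPX : P*X ≤ m*ρ := (le_abs_self _).trans (by rw [abs_mul]; gcongr)
  have hQY : Q*Y ≤ m*ρ := (le_abs_self _).trans (by rw [abs_mul]; gcongr)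
  have h5 : 4*g*(P*X+Q*Y) ≤ 4*ρ^2*(2*(m*ρ)) := by
    calc 4*g*(P*X+Q*Y) ≤ 4*g*(2*(m*ρ)) := by gcongr; linarith
      _ ≤ _ := by gcongr
  have h6 : 4*g*(P*X+Q*Y) + 8*g + 24*(X^2+Y^2) ≤ 8*m*ρ^3+32*ρ^2 := by
    have : X^2+Y^2 ≤ ρ^2 := by linarith
    linarith
  have h7 := mul_le_mul_of_nonneg_left h6 (by linarith : 0 ≤ A)
  have h8 : ρ^8 ≤ A*ρ^8 := le_mul_of_one_le_left (by positivity) hA1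
  have h9 := mul_lt_mul_of_pos_left hA2 (by linarith : 0 < A)
  linarith

set_option maxHeartbeats 4000000 in
lemma local_est (hp : 2 < p) (hL : 0 < L) (hs : ClassicalSolution p L T u)
    {t0 M ρ C0 : ℝ} (ht0 : 0 < t0) (hρ : 0 < ρ) (hM0 : 0 ≤ M)
    (hC0 : ∀ x y, |x| ≤ L/2 → y ∈ Icc (0:ℝ) (L/2) → pdt u x y t0 - pdxx u x y t0 ≤ C0) :
    ∃ C, ∀ x0 y0, 0 ≤ y0 →
      (∀ x y, (x-x0)^2+(y-y0)^2 ≤ ρ^2 → |x| ≤ L/2 ∧ y ≤ L/2) →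
      (∀ x y s t, (x-x0)^2+(y-y0)^2 ≤ ρ^2 → 0 ≤ y → 0 ≤ s → s ≤ L/16 → t ∈ Ioo 0 T →
        gradNorm u x (y+s) t ≤ M) →
      ∀ t, t0 ≤ t → t < T → pdt u x0 y0 t - pdxx u x0 y0 t ≤ C := by
  set m := p * M^(p-2) * M with hm
  have hm0 : 0 ≤ m := by positivity
  set N := |C0| + 3 + M^p + M^2 with hN
  have hN0 : 0 ≤ N := by positivity
  set A := 2*N*ρ^4 + 4*(8*m*ρ^3+32*ρ^2)+4*ρ^8 + 1 with hA
  have hρ4 : 0 < ρ^4 := by positivity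
  have q1 : 0 ≤ 4*(8*m*ρ^3+32*ρ^2) := by positivity
  have q2 : 0 ≤ 4*ρ^8 := by positivity
  have q3 : 0 ≤ 2*N*ρ^4 := by positivity
  refine ⟨A/ρ^4 + 1, ?_⟩
  intro x0 y0 hy0 hd hM T1 h01 hT1
  obtain ⟨h1, hh1, H1⟩ := Dop_unif hs hL ht0 hT1 (η := 1) one_pos
  have hT2 : (T1+T)/2 < T := by linarith
  obtain ⟨h2, hh2, H2⟩ := aux_unif (L := L) (T := T) ht0 hT2
    (pdyy u) (fun x y t hg => (hs.smooth hg.1 hg.2.1 hg.2.2).2.2.2.2.2.2.2.2.2.2.2.1)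
    (η := 1) one_pos
  obtain ⟨h3, hh3, H3⟩ := aux_unif (L := L) (T := T) ht0 hT2
    (Pc p (pdx u) u) (fun x y t hg => Pc_cont hp hs hg (hs.smooth hg.1 hg.2.1 hg.2.2).2.2.2.2.2.2.2.1)
    (η := 1/(2*M+1)) (by positivity)
  obtain ⟨h4, hh4, H4⟩ := aux_unif (L := L) (T := T) ht0 hT2
    (Pc p (pdy u) u) (fun x y t hg => Pc_cont hp hs hg (hs.smooth hg.1 hg.2.1 hg.2.2).2.2.2.2.2.2.2.2.1)
    (η := 1/(2*M+1)) (by positivity)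
  have hTT : 0 < (T - T1)/2 := by linarith
  obtain ⟨h, hh, hlt⟩ := exists_between
    (show 0 < min (min (min h1 h2) (min h3 h4)) (min (L/16) ((T-T1)/2)) by positivity)
  simp only [lt_min_iff] at hlt
  obtain ⟨⟨⟨hl1, hl2⟩, hl3, hl4⟩, hlL, hlT⟩ := hlt
  obtain ⟨-, H1⟩ := H1 h hh hl1 h01
  -- the compact set
  set S : Set (ℝ × ℝ × ℝ) := {q | (q.1-x0)^2+(q.2.1-y0)^2 ≤ ρ^2 ∧ 0 ≤ q.2.1 ∧ t0 ≤ q.2.2 ∧ q.2.2 ≤ T1}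
    with hS
  have hScl : IsClosed S := by
    have c1 : IsClosed {q : ℝ × ℝ × ℝ | (q.1-x0)^2+(q.2.1-y0)^2 ≤ ρ^2} :=
      isClosed_le (by fun_prop) (by fun_prop)
    have c2 : IsClosed {q : ℝ × ℝ × ℝ | 0 ≤ q.2.1} := isClosed_le (by fun_prop) (by fun_prop)
    have c3 : IsClosed {q : ℝ × ℝ × ℝ | t0 ≤ q.2.2} := isClosed_le (by fun_prop) (by fun_prop)
    have c4 : IsClosed {q : ℝ × ℝ × ℝ | q.2.2 ≤ T1} := isClosed_le (by fun_prop) (by fun_prop)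
    exact c1.inter (c2.inter (c3.inter c4))
  have hSc : IsCompact S := by
    refine IsCompact.of_isClosed_subset (isCompact_Icc.prod (isCompact_Icc.prod isCompact_Icc) :
      IsCompact (Icc (-L) L ×ˢ Icc (0:ℝ) L ×ˢ Icc t0 T1)) hScl ?_
    rintro ⟨x,y,t⟩ ⟨a,b,c,d⟩
    obtain ⟨e, f⟩ := hd _ _ a
    simp only at e f b c d
    have e' := abs_le.1 e
    exact ⟨⟨by linarith, by linarith⟩, ⟨b, by linarith⟩, c, d⟩
  have hScont : ContinuousOn (fun q : ℝ × ℝ × ℝ => (ρ^2 - (q.1-x0)^2 - (q.2.1-y0)^2)^2 *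
      (Dop h u q.1 q.2.1 q.2.2 + Sop h u q.1 q.2.1 q.2.2 ^ 2)) S := by
    rintro ⟨x,y,t⟩ ⟨a,b,c,d⟩
    obtain ⟨e, f⟩ := hd _ _ a
    simp only at e f b c d
    refine ContinuousAt.continuousWithinAt (ContinuousAt.mul (by fun_prop) ?_)
    exact (Dop_cont hs hh (by linarith) ⟨b, by linarith⟩ (by linarith) (by linarith)).add
      ((Sop_cont hs hh (by linarith) b (by linarith) (by linarith) (by linarith)).pow 2)
  obtain ⟨⟨x,y,t⟩, hq, hmax⟩ := hSc.exists_isMaxOn ⟨(x0,y0,T1), by simp [hS, hy0, h01]; positivity⟩ hScont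
  have hmax' : ∀ x' y' t', (x'-x0)^2+(y'-y0)^2 ≤ ρ^2 → 0 ≤ y' → t0 ≤ t' → t' ≤ T1 →
      (ρ^2 - (x'-x0)^2 - (y'-y0)^2)^2 * (Dop h u x' y' t' + Sop h u x' y' t' ^ 2) ≤
      (ρ^2 - (x-x0)^2 - (y-y0)^2)^2 * (Dop h u x y t + Sop h u x y t ^ 2) :=
    fun x' y' t' a b c d => by
      have h5 := isMaxOn_iff.1 hmax (x',y',t') ⟨a,b,c,d⟩
      exact h5
  clear hmax
  obtain ⟨hdisc, hy, htl, htu⟩ := hq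
  simp only at hdisc hy htl htu
  set g := ρ^2 - (x-x0)^2 - (y-y0)^2 with hg
  set A' := g^2 * (Dop h u x y t + Sop h u x y t ^ 2) with hA'
  have hg0 : 0 ≤ g := by rw [hg]; linarith
  have hg2 : g^2 ≤ ρ^4 := by
    calc g^2 ≤ (ρ^2)^2 := by
          gcongr; rw [hg]; linarith [sq_nonneg (x-x0), sq_nonneg (y-y0)]
      _ = ρ^4 := by ring
  obtain ⟨hxL, hyL⟩ := hd _ _ hdisc
  have htpos : 0 < t := by linarith
  have hxh : |x| + h < L := by linarith
  have hthT : t + h < T := by linarith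
  have hyh : y + h < L := by linarith
  obtain ⟨⟨ξ1, hξ1, eS⟩, ⟨ξ2, hξ2, eSy⟩⟩ := Sop_mvt hs hh (show |x| ≤ L by linarith) hy hyh.le htpos hthT
  have hδ : |Sop h u x y t| ≤ M := by
    rw [eS]
    have := hM x y (ξ1 - y) (t+h) hdisc hy (by linarith [hξ1.1]) (by linarith [hξ1.2]) ⟨by linarith, hthT⟩
    rw [add_sub_cancel] at this
    exact (pdy_le_grad _ _ _ _).trans this
  have hδ2 : Sop h u x y t ^ 2 ≤ M^2 := sq_le_sq' (abs_le.1 hδ).1 (abs_le.1 hδ).2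
  have hF := (abs_lt.1 (H1 x y t hxL ⟨hy, by linarith⟩ ⟨htl, htu⟩))
  have hAA : A' ≤ A := by
    by_contra hcon
    push Not at hcon
    have hApos : 1 ≤ A' := by linarith
    have hgpos : 0 < g := by
      rcases hg0.eq_or_lt with e | e
      · rw [← e] at hA'; simp at hA'; linarith
      · exact e
    have hWb : ∀ B, 0 ≤ B → B ≤ N → Dop h u x y t + Sop h u x y t ^ 2 ≤ B → False := by
      intro B hB hBN hW
      have : A' ≤ ρ^4 * N := by
        rw [hA']
        calc g^2 * (Dop h u x y t + Sop h u x y t ^ 2) ≤ g^2 * N := by gcongr; linarith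
          _ ≤ _ := by gcongr
      linarith
    have hMp : 0 ≤ M^p := by positivity
    have htlt : t0 < t := by
      rcases htl.eq_or_lt with e | e
      · exfalso
        refine hWb N hN0 le_rfl ?_
        have := hC0 x y hxL ⟨hy, hyL⟩
        rw [e] at this
        have := le_abs_self C0
        linarith [hF.2]
      · exact e
    have hypos : 0 < y := by
      rcases hy.eq_or_lt with e | e
      · exfalso
        refine hWb N hN0 le_rfl ?_
        have : Dop h u x y t = 0 := by rw [← e]; exact Dop_zero hs hh hxh htpos hthT
        rw [this]
        have := abs_nonneg C0
        linarith
      · exact e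
    have hWK : Dop h u x y t + Sop h u x y t ^ 2 = A' / g^2 := by
      rw [hA']; field_simp
    have hcmp : ∀ x' y' t', 0 < ρ^2 - (x'-x0)^2 - (y'-y0)^2 → 0 ≤ y' → t0 ≤ t' → t' ≤ T1 →
        Dop h u x' y' t' + Sop h u x' y' t' ^ 2 ≤ A' / (ρ^2 - (x'-x0)^2 - (y'-y0)^2)^2 := by
      intro x' y' t' a b c d
      rw [le_div_iff₀ (by positivity), mul_comm]
      exact hmax' x' y' t' (by linarith) b c d
    obtain ⟨dx, dxx, dy, dyy, dt⟩ := Dop_all hs hh hxh.le ⟨hy, by linarith⟩ htpos hthT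
    obtain ⟨sx, sxx, sy, syy, st⟩ := Sop_all hs hh (show |x| ≤ L by linarith) hy hyh.le htpos hthT
    -- time
    have ht' : 0 ≤ Dop h (pdt u) x y t + 2 * Sop h u x y t * Sop h (pdt u) x y t := by
      refine aux_left_deriv htlt (W_deriv1 dt st) ?_
      intro s h1 h2
      rw [hWK]
      exact hcmp x y s hgpos hy h1 (h2.trans htu)
    -- x slice
    have hX := aux_second_le (x := x)
      (f := fun s => (Dop h u s y t + Sop h u s y t ^ 2) - A' / ((ρ^2 - (y-y0)^2) - (s-x0)^2)^2)
      (f' := fun s => (Dop h (pdx u) s y t + 2 * Sop h u s y t * Sop h (pdx u) s y t) -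
        4*A'*(s-x0)/((ρ^2 - (y-y0)^2) - (s-x0)^2)^3)
      (c := (Dop h (pdxx u) x y t + 2 * (Sop h (pdx u) x y t)^2 + 2 * Sop h u x y t * Sop h (pdxx u) x y t) -
        (4*A'/((ρ^2 - (y-y0)^2) - (x-x0)^2)^3 + 24*A'*(x-x0)^2/((ρ^2 - (y-y0)^2) - (x-x0)^2)^4))
      (by
        have e1 : ∀ᶠ s in nhds x, 0 < ρ^2 - (y-y0)^2 - (s-x0)^2 :=
          (by fun_prop : ContinuousAt (fun s => ρ^2 - (y-y0)^2 - (s-x0)^2) x).eventually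
            (lt_mem_nhds (by rw [hg] at hgpos; linarith))
        have e2 : ∀ᶠ s in nhds x, |s| + h < L :=
          (by fun_prop : ContinuousAt (fun s : ℝ => |s| + h) x).eventually (gt_mem_nhds hxh)
        filter_upwards [e1, e2] with s k1 k2
        obtain ⟨a, -⟩ := Dop_all hs hh k2.le ⟨hy, by linarith⟩ htpos hthT
        obtain ⟨b, -⟩ := Sop_all hs hh (show |s| ≤ L by linarith) hy hyh.le htpos hthT
        exact (W_deriv1 a b).sub (K_slice k1.ne'))
      ((W_deriv2 dxx sx sxx).sub (K_slice2 (by rw [hg] at hgpos; linarith)))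
      (by
        have e1 : ∀ᶠ s in nhds x, 0 < ρ^2 - (y-y0)^2 - (s-x0)^2 :=
          (by fun_prop : ContinuousAt (fun s => ρ^2 - (y-y0)^2 - (s-x0)^2) x).eventually
            (lt_mem_nhds (by rw [hg] at hgpos; linarith))
        filter_upwards [e1] with s k1
        have h5 := hcmp s y t (by linarith) hy htl htu
        have e3 : ρ^2 - (y-y0)^2 - (s-x0)^2 = ρ^2 - (s-x0)^2 - (y-y0)^2 := by ring
        have e4 : ρ^2 - (y-y0)^2 - (x-x0)^2 = g := by rw [hg]; ring
        rw [e3, e4, hWK]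
        linarith)
    have hY := aux_second_le (x := y)
      (f := fun s => (Dop h u x s t + Sop h u x s t ^ 2) - A' / ((ρ^2 - (x-x0)^2) - (s-y0)^2)^2)
      (f' := fun s => (Dop h (pdy u) x s t + 2 * Sop h u x s t * Sop h (pdy u) x s t) -
        4*A'*(s-y0)/((ρ^2 - (x-x0)^2) - (s-y0)^2)^3)
      (c := (Dop h (pdyy u) x y t + 2 * (Sop h (pdy u) x y t)^2 + 2 * Sop h u x y t * Sop h (pdyy u) x y t) -
        (4*A'/((ρ^2 - (x-x0)^2) - (y-y0)^2)^3 + 24*A'*(y-y0)^2/((ρ^2 - (x-x0)^2) - (y-y0)^2)^4))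
      (by
        have e1 : ∀ᶠ s in nhds y, 0 < ρ^2 - (x-x0)^2 - (s-y0)^2 :=
          (by fun_prop : ContinuousAt (fun s => ρ^2 - (x-x0)^2 - (s-y0)^2) y).eventually
            (lt_mem_nhds hgpos)
        have e2 : ∀ᶠ s in nhds y, s + h < L :=
          (by fun_prop : ContinuousAt (fun s : ℝ => s + h) y).eventually (gt_mem_nhds hyh)
        filter_upwards [e1, e2, lt_mem_nhds hypos] with s k1 k2 k3
        obtain ⟨-, -, a, -⟩ := Dop_all hs hh hxh.le ⟨k3.le, by linarith⟩ htpos hthT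
        obtain ⟨-, -, b, -⟩ := Sop_all hs hh (show |x| ≤ L by linarith) k3.le k2.le htpos hthT
        exact (W_deriv1 a b).sub (K_slice k1.ne'))
      ((W_deriv2 dyy sy syy).sub (K_slice2 hgpos.ne'))
      (by
        have e1 : ∀ᶠ s in nhds y, 0 < ρ^2 - (x-x0)^2 - (s-y0)^2 :=
          (by fun_prop : ContinuousAt (fun s => ρ^2 - (x-x0)^2 - (s-y0)^2) y).eventually
            (lt_mem_nhds hgpos)
        filter_upwards [e1, lt_mem_nhds hypos] with s k1 k3
        have h5 := hcmp x s t k1 k3.le htl htu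
        rw [← hg, hWK]
        linarith)
    have e4 : ρ^2 - (y-y0)^2 - (x-x0)^2 = g := by rw [hg]; ring
    rw [e4] at hX
    rw [← hg] at hY
    have hMb : gradNorm u x y (t+h) ≤ M := by
      simpa using hM x y 0 (t+h) hdisc hy le_rfl (by positivity) ⟨by linarith, hthT⟩
    have hMb0 : gradNorm u x y t ≤ M := by
      simpa using hM x y 0 t hdisc hy le_rfl (by positivity) ⟨by linarith, by linarith⟩
    obtain ⟨s0, s1⟩ := Sop_sub hp hs hh (show |x| < L by linarith) hypos hyh htpos hthT
    have hxL' : |x| ≤ L := by linarith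
    have hyI : y ∈ Icc (0:ℝ) L := ⟨hy, by linarith⟩
    have hyI' : y + h ∈ Icc (0:ℝ) L := ⟨by linarith, by linarith⟩
    have htI : t + h ∈ Icc t0 ((T1+T)/2) := ⟨by linarith, by linarith⟩
    have hhabs : |h| = h := abs_of_pos hh
    have hcore := core_alg hδ (Dop_sub hp hs hh hxh ⟨hypos, by linarith⟩ htpos hthT) s0 s1
      (H3 x y (t+h) x (y+h) (t+h) hxL' hxL' hyI hyI' htI htI (by simpa using hh3)
        (by simpa [hhabs] using hl3) (by simpa using hh3))
      (H4 x y (t+h) x (y+h) (t+h) hxL' hxL' hyI hyI' htI htI (by simpa using hh4)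
        (by simpa [hhabs] using hl4) (by simpa using hh4)) ht' hX.1 hY.1 hX.2 hY.2
    have hyy := abs_lt.1 (H2 x y t x ξ2 (t+h) hxL' hxL' hyI ⟨by linarith [hξ2.1], by linarith [hξ2.2]⟩
      ⟨htl, by linarith⟩ htI (by simpa using hh2)
      (by rw [abs_lt]; constructor <;> linarith [hξ2.1, hξ2.2]) (by simpa [hhabs] using hl2))
    rw [← eSy] at hyy
    have hpde := hs.pde (x := x) (y := y) (t := t) (by linarith) ⟨hypos, by linarith⟩ ⟨htpos, by linarith⟩
    have hHM : gradNorm u x y t ^ p ≤ M^p :=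
      Real.rpow_le_rpow (grad_nonneg _ _ _ _) hMb0 (by linarith)
    refine loc_alg (A := A') (g := g) (X := x-x0) (Y := y-y0) (m := m) (ρ := ρ) (N := N) hρ hgpos hg
      (Pc_bound hp (pdx_le_grad _ _ _ _) hMb) (Pc_bound hp (pdy_le_grad _ _ _ _) hMb) hApos
      (by linarith) (by linarith) hN0 (δy := Sop h (pdy u) x y t) (δx := Sop h (pdx u) x y t) ?_ ?_
    · rw [← hWK]
      have := abs_nonneg C0
      linarith [hF.2, hyy.1]
    · linarith
  have hfin := (hmax' x0 y0 T1 (by simp; positivity) hy0 h01 le_rfl).trans hAA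
  have hx0 : |x0| ≤ L/2 ∧ y0 ≤ L/2 := hd x0 y0 (by simp; positivity)
  have hF0 := (abs_lt.1 (H1 x0 y0 T1 hx0.1 ⟨hy0, by linarith⟩ ⟨h01, le_rfl⟩))
  have : Dop h u x0 y0 T1 + Sop h u x0 y0 T1 ^ 2 ≤ A / ρ^4 := by
    rw [le_div_iff₀ hρ4]
    refine le_trans (le_of_eq ?_) hfin
    ring
  have := sq_nonneg (Sop h u x0 y0 T1)
  linarith

set_option maxHeartbeats 1000000 in
lemma global_est (hp : 2 < p) (hL : 0 < L) (hs : ClassicalSolution p L T u)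
    {t0 r C : ℝ} (ht0 : 0 < t0) (hr : 0 < r) (hrL : r ≤ L/4)
    (hC0 : ∀ x y, |x| ≤ L/2 → y ∈ Icc (0:ℝ) (L/2) → pdt u x y t0 - pdxx u x y t0 ≤ C)
    (hC1 : ∀ x y t, |x| ≤ r → y ∈ Icc (0:ℝ) r → (|x| = r ∨ y = r) → t0 ≤ t → t < T →
      pdt u x y t - pdxx u x y t ≤ C) (hC : 0 ≤ C) :
    ∀ x y t, |x| ≤ r → y ∈ Icc (0:ℝ) r → t0 ≤ t → t < T →
      pdt u x y t - pdxx u x y t ≤ C + 3 := by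
  intro x1 y1 T1 hx1 hy1 h01 hT1
  obtain ⟨h1, hh1, H1⟩ := Dop_unif hs hL ht0 hT1 (η := 1) one_pos
  have hTT : 0 < (T - T1)/2 := by linarith
  obtain ⟨h, hh, hlt⟩ := exists_between
    (show 0 < min h1 (min (L/16) ((T-T1)/2)) by positivity)
  simp only [lt_min_iff] at hlt
  obtain ⟨hl1, hlL, hlT⟩ := hlt
  obtain ⟨-, H1⟩ := H1 h hh hl1 h01
  have hTpos : 0 < T := by linarith
  have hSc : IsCompact (Icc (-r) r ×ˢ Icc (0:ℝ) r ×ˢ Icc t0 T1) :=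
    isCompact_Icc.prod (isCompact_Icc.prod isCompact_Icc)
  have hcont : ContinuousOn (fun q : ℝ × ℝ × ℝ => Dop h u q.1 q.2.1 q.2.2 - (1/T) * (q.2.2 - t0))
      (Icc (-r) r ×ˢ Icc (0:ℝ) r ×ˢ Icc t0 T1) := by
    rintro ⟨x,y,t⟩ ⟨a,b,c⟩
    have e := abs_le.2 a
    simp only at e b c
    refine ContinuousAt.continuousWithinAt (ContinuousAt.sub ?_ (by fun_prop))
    exact Dop_cont hs hh (by linarith) ⟨b.1, by linarith [b.2]⟩ (by linarith [c.1]) (by linarith [c.2])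
  obtain ⟨⟨x,y,t⟩, hq, hmax⟩ := hSc.exists_isMaxOn
    ⟨(x1,y1,T1), abs_le.1 hx1, hy1, h01, le_rfl⟩ hcont
  have hmax' : ∀ x' y' t', |x'| ≤ r → 0 ≤ y' → y' ≤ r → t0 ≤ t' → t' ≤ T1 →
      Dop h u x' y' t' - (1/T) * (t' - t0) ≤ Dop h u x y t - (1/T) * (t - t0) := by
    intro x' y' t' a b b' c d
    have h5 := isMaxOn_iff.1 hmax (x',y',t') ⟨abs_le.1 a,⟨b,b'⟩,⟨c,d⟩⟩
    exact h5
  clear hmax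
  obtain ⟨hx, hy, ht⟩ := hq
  simp only at hx hy ht
  have hx' := abs_le.2 hx
  have hxh : |x| + h < L := by linarith
  have htpos : 0 < t := by linarith [ht.1]
  have hthT : t + h < T := by linarith [ht.2]
  have hF := abs_lt.1 (H1 x y t (by linarith) ⟨hy.1, by linarith [hy.2]⟩ ht)
  have hTi : 0 < 1/T := by positivity
  have hkey : Dop h u x y t ≤ C + 1 := by
    by_contra hcon
    push Not at hcon
    have htlt : t0 < t := by
      rcases ht.1.eq_or_lt with e | e
      · exfalso
        have := hC0 x y (by linarith) ⟨hy.1, by linarith [hy.2]⟩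
        rw [e] at this
        linarith [hF.2]
      · exact e
    have hypos : 0 < y := by
      rcases hy.1.eq_or_lt with e | e
      · exfalso
        have : Dop h u x y t = 0 := by rw [← e]; exact Dop_zero hs hh hxh htpos hthT
        linarith
      · exact e
    have hside : ∀ (_ : |x| = r ∨ y = r), False := by
      intro e
      have := hC1 x y t hx' hy e ht.1 (by linarith [ht.2])
      linarith [hF.2]
    have hxr : |x| < r := lt_of_le_of_ne hx' fun e => hside (Or.inl e)
    have hyr : y < r := lt_of_le_of_ne hy.2 fun e => hside (Or.inr e)
    obtain ⟨dx, dxx, dy, dyy, dt⟩ := Dop_all hs hh hxh.le ⟨hy.1, by linarith⟩ htpos hthT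
    have hT' : 0 ≤ Dop h (pdt u) x y t - 1/T := by
      have hd : HasDerivAt (fun s => Dop h u x y s - (1/T) * (s - t0)) (Dop h (pdt u) x y t - 1/T) t := by
        have := dt.sub (((hasDerivAt_id t).sub_const t0).const_mul (1/T))
        exact HasDerivAt.congr_deriv this (by rw [mul_one])
      refine aux_left_deriv htlt hd ?_
      intro s h1 h2
      exact hmax' x y s hx' hy.1 hy.2 h1 (h2.trans ht.2)
    have hX := aux_second_le (x := x) (f := fun s => Dop h u s y t)
      (f' := fun s => Dop h (pdx u) s y t)
      (by
        filter_upwards [(by fun_prop : ContinuousAt (fun s : ℝ => |s| + h) x).eventually (gt_mem_nhds hxh)]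
          with s k
        exact (Dop_all hs hh k.le ⟨hy.1, by linarith⟩ htpos hthT).1) dxx
      (by
        filter_upwards [(by fun_prop : ContinuousAt (fun s : ℝ => |s|) x).eventually (gt_mem_nhds hxr)]
          with s k
        linarith [hmax' s y t k.le hy.1 hy.2 ht.1 ht.2])
    have hY := aux_second_le (x := y) (f := fun s => Dop h u x s t)
      (f' := fun s => Dop h (pdy u) x s t)
      (by
        filter_upwards [lt_mem_nhds hypos, gt_mem_nhds hyr] with s k k'
        exact (Dop_all hs hh hxh.le ⟨k.le, by linarith⟩ htpos hthT).2.2.1) dyy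
      (by
        filter_upwards [lt_mem_nhds hypos, gt_mem_nhds hyr] with s k k'
        linarith [hmax' x s t hx' k.le k'.le ht.1 ht.2])
    have hsub := Dop_sub hp hs hh hxh ⟨hypos, by linarith⟩ htpos hthT
    rw [hX.1, hY.1] at hsub
    linarith [hX.2, hY.2]
  have hfin := hmax' x1 y1 T1 hx1 hy1.1 hy1.2 h01 le_rfl
  have hF1 := abs_lt.1 (H1 x1 y1 T1 (by linarith) ⟨hy1.1, by linarith [hy1.2]⟩ ⟨h01, le_rfl⟩)
  have k1 : (1/T) * (T1 - t0) ≤ 1 := by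
    rw [one_div, inv_mul_le_iff₀ hTpos]; linarith
  have k2 : 0 ≤ (1/T) * (t - t0) := mul_nonneg hTi.le (by linarith [ht.1])
  linarith [hF1.1]

lemma F_bound (hp : 2 < p) (hL : 0 < L) (hT : 0 < T) (hs : ClassicalSolution p L T u)
    (hgbu : IsolatedGBU L T u) :
    ∃ C, 0 < C ∧ ∀ x y t, |x| ≤ L/4 → y ∈ Icc (0:ℝ) (L/4) → T/2 ≤ t → t < T →
      pdt u x y t - pdxx u x y t ≤ C := by
  have hT2 : T/2 ∈ Ioo 0 T := ⟨by linarith, by linarith⟩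
  obtain ⟨C0, hC0⟩ : ∃ C0, ∀ x y, |x| ≤ L/2 → y ∈ Icc (0:ℝ) (L/2) →
      pdt u x y (T/2) - pdxx u x y (T/2) ≤ C0 := by
    have hc : IsCompact (Icc (-L) L ×ˢ Icc (0:ℝ) L ×ˢ Icc (T/2) (T/2)) :=
      isCompact_Icc.prod (isCompact_Icc.prod isCompact_Icc)
    obtain ⟨C0, H⟩ := hc.exists_bound_of_continuousOn
      (f := fun q : ℝ × ℝ × ℝ => pdt u q.1 q.2.1 q.2.2 - pdxx u q.1 q.2.1 q.2.2) (by
        rintro ⟨x,y,t⟩ ⟨hx,hy,ht⟩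
        have e : t = T/2 := le_antisymm ht.2 ht.1
        obtain ⟨-,-,-,-,-,-,-,-,-,a,b,-⟩ := hs.smooth (abs_le.2 hx) hy (show t ∈ Ioo 0 T by rw [e]; exact hT2)
        exact (a.sub b).continuousWithinAt)
    refine ⟨C0, fun x y hx hy => ?_⟩
    have hx := abs_le.1 hx
    exact (le_abs_self _).trans (H (x,y,T/2)
      ⟨⟨by linarith, by linarith⟩, ⟨hy.1, by linarith [hy.2]⟩, le_rfl, le_rfl⟩)
  obtain ⟨M, hM⟩ := hgbu.bounded
    ((Icc (-L) L ×ˢ Icc (0:ℝ) L) ∩ {q | L/8 ≤ max |q.1| q.2})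
    ((isCompact_Icc.prod isCompact_Icc).inter_right (isClosed_le (by fun_prop) (by fun_prop))) (by
      rintro ⟨x,y⟩ ⟨h1, h2⟩
      refine ⟨h1, ?_⟩
      rintro h
      simp only [mem_singleton_iff, Prod.mk.injEq] at h
      simp only [mem_setOf_eq, h.1, h.2] at h2
      simp at h2
      linarith)
  have hM' : ∀ x y t, |x| ≤ L → y ∈ Icc (0:ℝ) L → (L/8 ≤ |x| ∨ L/8 ≤ y) → t ∈ Ioo 0 T →
      gradNorm u x y t ≤ |M| := by
    intro x y t a b c d
    exact (hM (x,y) ⟨⟨abs_le.1 a, b⟩, le_max_iff.2 c⟩ t d).trans (le_abs_self _)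
  obtain ⟨C1, hC1⟩ := local_est (M := |M|) (ρ := L/16) hp hL hs hT2.1 (by positivity) (abs_nonneg _) hC0
  have hball : ∀ a b c d : ℝ, (a-b)^2 + (c-d)^2 ≤ (L/16)^2 → |a-b| ≤ L/16 ∧ |c-d| ≤ L/16 := by
    intro a b c d hh
    exact ⟨abs_le_of_sq_le_sq (by linarith [sq_nonneg (c-d)]) (by positivity),
      abs_le_of_sq_le_sq (by linarith [sq_nonneg (a-b)]) (by positivity)⟩
  have hside : ∀ x y t, |x| ≤ L/4 → y ∈ Icc (0:ℝ) (L/4) → (|x| = L/4 ∨ y = L/4) → T/2 ≤ t → t < T →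
      pdt u x y t - pdxx u x y t ≤ |C0| + |C1| := by
    intro x0 y0 t hx0 hy0 hor h1 h2
    have hdd : ∀ x y, (x-x0)^2+(y-y0)^2 ≤ (L/16)^2 → |x| ≤ L/2 ∧ y ≤ L/2 := by
      intro x y hh
      obtain ⟨a, b⟩ := hball _ _ _ _ hh
      have a' := abs_sub_abs_le_abs_sub x x0
      have b' := abs_le.1 b
      exact ⟨by linarith, by linarith [hy0.2, b'.2]⟩
    refine (hC1 x0 y0 hy0.1 hdd ?_ t h1 h2).trans (by
      linarith [le_abs_self C1, abs_nonneg C0])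
    intro x y s t hh hy hs0 hs1 ht
    obtain ⟨a, b⟩ := hball _ _ _ _ hh
    have b' := abs_le.1 b
    obtain ⟨c, d⟩ := hdd _ _ hh
    refine hM' x (y+s) t (by linarith) ⟨by linarith, by linarith⟩ ?_ ht
    rcases hor with e | e
    · left
      have := abs_sub_abs_le_abs_sub x0 x
      rw [abs_sub_comm] at this
      linarith
    · right
      linarith [b'.1]
  refine ⟨|C0| + |C1| + 3, by positivity, ?_⟩
  exact global_est hp hL hs hT2.1 (by positivity) le_rfl
    (fun x y a b => (hC0 x y a b).trans (by linarith [le_abs_self C0, abs_nonneg C1]))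
    hside (by positivity)

end sol

lemma ode_aux {p Y : ℝ} (hp : 2 < p) {v v' : ℝ → ℝ} (hY : 0 < Y)
    (hc : ContinuousOn v (Icc 0 Y)) (hd : ∀ s ∈ Ioo 0 Y, HasDerivAt v (v' s) s)
    (h1 : ∀ s ∈ Ioo 0 Y, v' s ≤ 0)
    (h2 : ∀ s ∈ Ioo 0 Y, 0 < v s → v' s ≤ - (v s)^p) (hpos : 0 < v Y) :
    0 < v 0 ∧ v 0 ^ (1-p) + (p-1)*Y ≤ v Y ^ (1-p) := by
  have hanti : AntitoneOn v (Icc 0 Y) := by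
    refine antitoneOn_of_deriv_nonpos (convex_Icc _ _) hc ?_ ?_
    · intro s hs
      rw [interior_Icc] at hs
      exact (hd s hs).differentiableAt.differentiableWithinAt
    · intro s hs
      rw [interior_Icc] at hs
      rw [(hd s hs).deriv]; exact h1 s hs
  have hp' : ∀ s ∈ Icc 0 Y, 0 < v s := fun s hs =>
    hpos.trans_le (hanti hs ⟨hY.le, le_rfl⟩ hs.2)
  refine ⟨hp' 0 ⟨le_rfl, hY.le⟩, ?_⟩
  have hmono : MonotoneOn (fun s => v s ^ (1-p) - (p-1)*s) (Icc 0 Y) := by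
    have hder : ∀ s ∈ Ioo 0 Y, HasDerivAt (fun s => v s ^ (1-p) - (p-1)*s)
        (v' s * (1-p) * v s ^ (1-p-1) - (p-1)) s := fun s hs => by
      have a := (hd s hs).rpow_const (p := 1-p) (Or.inl (hp' s (Ioo_subset_Icc_self hs)).ne')
      have b := (hasDerivAt_id s).const_mul (p-1)
      exact HasDerivAt.congr_deriv (a.sub b) (by rw [mul_one])
    refine monotoneOn_of_deriv_nonneg (convex_Icc _ _) ?_ ?_ ?_
    · refine ContinuousOn.sub (hc.rpow_const fun s hs => Or.inl (hp' s hs).ne') (by fun_prop)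
    · intro s hs
      rw [interior_Icc] at hs
      exact (hder s hs).differentiableAt.differentiableWithinAt
    · intro s hs
      rw [interior_Icc] at hs
      rw [(hder s hs).deriv]
      have hv := hp' s (Ioo_subset_Icc_self hs)
      have k := h2 s hs hv
      have e : v s ^ p * v s ^ (1-p-1) = 1 := by
        rw [← Real.rpow_add hv]; simp
      have k2 := mul_le_mul_of_nonneg_right k (show 0 ≤ v s ^ (1-p-1) by positivity)
      have k3 : v' s * v s ^ (1-p-1) ≤ -1 := by linarith
      have k4 := mul_le_mul_of_nonneg_left k3 (by linarith : 0 ≤ p - 1)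
      linarith
  have := hmono (show (0:ℝ) ∈ Icc 0 Y from ⟨le_rfl, hY.le⟩) (show Y ∈ Icc 0 Y from ⟨hY.le, le_rfl⟩) hY.le
  simp only [mul_zero, sub_zero] at this
  linarith

lemma inv_aux {p v B : ℝ} (hp : 2 < p) (hv : 0 < v) (hB : 0 < B) (h : B ≤ v^(1-p)) :
    v ≤ B ^ (-(1/(p-1))) := by
  have h1 := Real.rpow_le_rpow_of_nonpos hB h (show -(1/(p-1)) ≤ 0 by
    have : 0 < p - 1 := by linarith
    have : 0 < 1/(p-1) := by positivity
    linarith)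
  rw [← Real.rpow_mul hv.le] at h1
  have : (1-p) * -(1/(p-1)) = 1 := by
    have : p - 1 ≠ 0 := by linarith
    field_simp; ring
  rwa [this, Real.rpow_one] at h1

/-- Proposition 2.4: one-dimensional upper estimates near the singularity.
Here `β = 1/(p-1)`, `d_p = β^β` and `c_p = (1-β)⁻¹ d_p`. -/
theorem upper_1d_estimates (p L T : ℝ) (hp : 2 < p) (hL : 0 < L) (hT : 0 < T)
    (u : ℝ → ℝ → ℝ → ℝ)
    (hsol : ClassicalSolution p L T u) (hgbu : IsolatedGBU L T u)
    (hmon : MonCond L T u) :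
    ∃ C ρ : ℝ, 0 < C ∧ 0 < ρ ∧ ρ < L ∧ ρ < T ∧
      ∀ x y t : ℝ, |x| < ρ → y ∈ Ioo (0:ℝ) ρ → t ∈ Ico (T - ρ) T →
        (pdy u x y t ≤
          ((pdy u x 0 t) ^ (1 - p) + (p - 1) * y) ^ (-(1/(p-1))) + 2 * C * y) ∧
        (pdy u x y t ≤
          ((1/(p-1) : ℝ) ^ (1/(p-1))) * y ^ (-(1/(p-1))) + 2 * C * y) ∧
        (u x y t ≤
          (1 - 1/(p-1))⁻¹ * ((1/(p-1) : ℝ) ^ (1/(p-1))) * y ^ (1 - 1/(p-1)) + C * y ^ 2) := by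
  obtain ⟨K, hK, hF⟩ := F_bound hp hL hT hsol hgbu
  have hp1 : 0 < p - 1 := by linarith
  set β := 1/(p-1) with hβ
  have hβ0 : 0 < β := by positivity
  have hβ1 : β < 1 := by rw [hβ, div_lt_one hp1]; linarith
  set ρ := min (L/4) (T/2) with hρ
  have hρL : ρ ≤ L/4 := min_le_left _ _
  have hρT : ρ ≤ T/2 := min_le_right _ _
  have hρ0 : 0 < ρ := by positivity
  refine ⟨K/2, ρ, by positivity, hρ0, by linarith, by linarith, ?_⟩
  intro x y t hx hy ht
  have ht' : t ∈ Ioo 0 T := ⟨by linarith [ht.1], ht.2⟩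
  have hxL : |x| < L := by linarith
  have hdom : ∀ s ∈ Icc 0 ρ, DomOK L T x s t := fun s hs =>
    ⟨hxL.le, ⟨hs.1, by linarith [hs.2]⟩, ht'⟩
  have e2 : 2 * (K/2) = K := by ring
  rw [e2]
  have hu0 : u x 0 t = 0 := hsol.bc hxL ht'
  -- the normal derivative at the boundary is nonnegative
  have hb0 : 0 ≤ pdy u x 0 t := by
    have h1 := (sol_y hsol (hdom 0 ⟨le_rfl, hρ0.le⟩)).hasDerivWithinAt (s := Ioi 0)
    rw [hasDerivWithinAt_iff_tendsto_slope' (by simp)] at h1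
    refine ge_of_tendsto h1 ?_
    filter_upwards [Ioc_mem_nhdsGT hL] with s hs
    rw [slope_def_field, hu0]
    have := hsol.nonneg hxL.le (⟨hs.1.le, hs.2⟩ : s ∈ Icc (0:ℝ) L) ht'
    exact div_nonneg (by linarith) (by linarith [hs.1])
  have hbp : 0 ≤ pdy u x 0 t ^ (1-p) := Real.rpow_nonneg hb0 _
  -- main ODE estimate
  have hv : ∀ Y ∈ Ioo 0 ρ, 0 < pdy u x Y t - K * Y →
      pdy u x 0 t ^ (1-p) + (p-1)*Y ≤ (pdy u x Y t - K * Y) ^ (1-p) := by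
    intro Y hY hpos
    have hder : ∀ s ∈ Icc 0 Y, HasDerivAt (fun s => pdy u x s t - K * s) (pdyy u x s t - K) s := by
      intro s hs
      have := (sol_yy hsol (hdom s ⟨hs.1, by linarith [hs.2, hY.2]⟩)).sub
        ((hasDerivAt_id s).const_mul K)
      exact HasDerivAt.congr_deriv this (by rw [mul_one])
    have hyy : ∀ s ∈ Ioo 0 Y, pdyy u x s t - K ≤ - gradNorm u x s t ^ p := by
      intro s hs
      have h1 := hsol.pde hxL (⟨hs.1, by linarith [hs.2, hY.2]⟩ : s ∈ Ioo (0:ℝ) L) ht'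
      have h2 := hF x s t (by linarith) ⟨hs.1.le, by linarith [hs.2, hY.2]⟩ (by linarith [ht.1]) ht.2
      linarith
    have := ode_aux hp (v := fun s => pdy u x s t - K * s) (v' := fun s => pdyy u x s t - K) hY.1
      (fun s hs => (hder s hs).continuousAt.continuousWithinAt)
      (fun s hs => hder s (Ioo_subset_Icc_self hs))
      (fun s hs => (hyy s hs).trans (by
        have := Real.rpow_nonneg (grad_nonneg u x s t) p
        linarith))
      (fun s hs hvs => (hyy s hs).trans (by
        have hKs : 0 ≤ K * s := mul_nonneg hK.le hs.1.le
        have h1 : pdy u x s t - K * s ≤ gradNorm u x s t :=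
          le_trans (by linarith) ((le_abs_self _).trans (pdy_le_grad u x s t))
        have := Real.rpow_le_rpow hvs.le h1 (show 0 ≤ p by linarith)
        linarith)) hpos
    simpa using this.2
  have hii : ∀ Y ∈ Ioo 0 ρ, pdy u x Y t ≤ β^β * Y^(-β) + K * Y := by
    intro Y hY
    by_cases hpos : 0 < pdy u x Y t - K * Y
    · have h1 := hv Y hY hpos
      have h2 := inv_aux hp hpos (B := (p-1)*Y) (mul_pos hp1 hY.1) (by linarith)
      rw [Real.mul_rpow hp1.le hY.1.le, ← hβ] at h2
      have h3 : (p-1)^(-β) = β^β := by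
        rw [Real.rpow_neg hp1.le, ← Real.inv_rpow hp1.le, hβ, one_div]
      rw [h3] at h2
      linarith
    · have h1 : 0 ≤ Y^(-β) := Real.rpow_nonneg hY.1.le _
      have h2 : 0 ≤ β^β := Real.rpow_nonneg hβ0.le _
      have := mul_nonneg h2 h1
      linarith
  refine ⟨?_, hii y hy, ?_⟩
  · by_cases hpos : 0 < pdy u x y t - K * y
    · have h1 := hv y hy hpos
      have h2 := inv_aux hp hpos (B := pdy u x 0 t ^ (1-p) + (p-1)*y)
        (by have := mul_pos hp1 hy.1; linarith) h1
      linarith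
    · have : 0 ≤ (pdy u x 0 t ^ (1-p) + (p-1)*y) ^ (-β) :=
        Real.rpow_nonneg (by have := mul_pos hp1 hy.1; linarith) _
      linarith
  · have h1β : 0 < 1 - β := by linarith
    set c := (1-β)⁻¹ * β^β with hc
    have hder : ∀ s ∈ Ioo 0 y, HasDerivAt (fun s => u x s t - c * s^(1-β) - K/2 * s^2)
        (pdy u x s t - β^β * s^(-β) - K * s) s := by
      intro s hs
      have a := sol_y hsol (hdom s ⟨hs.1.le, by linarith [hs.2, hy.2]⟩)
      have b := (Real.hasDerivAt_rpow_const (x := s) (p := 1-β) (Or.inl hs.1.ne')).const_mul c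
      have d := (hasDerivAt_pow 2 s).const_mul (K/2)
      refine HasDerivAt.congr_deriv ((a.sub b).sub d) ?_
      have e1 : (1 - β - 1) = -β := by ring
      rw [e1, hc]
      have : (1-β)⁻¹ * β^β * ((1-β) * s^(-β)) = β^β * s^(-β) := by
        field_simp
      rw [this]
      push_cast
      ring
    have hanti : AntitoneOn (fun s => u x s t - c * s^(1-β) - K/2 * s^2) (Icc 0 y) := by
      refine antitoneOn_of_deriv_nonpos (convex_Icc _ _) ?_ ?_ ?_
      · intro s hs
        have a := (sol_y hsol (hdom s ⟨hs.1, by linarith [hs.2, hy.2]⟩)).continuousAt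
        have b : ContinuousAt (fun s : ℝ => s^(1-β)) s :=
          Real.continuousAt_rpow_const _ _ (Or.inr h1β.le)
        exact ((a.sub (b.const_mul c)).sub (by fun_prop)).continuousWithinAt
      · intro s hs
        rw [interior_Icc] at hs
        exact (hder s hs).differentiableAt.differentiableWithinAt
      · intro s hs
        rw [interior_Icc] at hs
        rw [(hder s hs).deriv]
        linarith [hii s ⟨hs.1, by linarith [hs.2, hy.2]⟩]
    have h5 := hanti (show (0:ℝ) ∈ Icc 0 y from ⟨le_rfl, hy.1.le⟩)
      (show y ∈ Icc 0 y from ⟨hy.1.le, le_rfl⟩) hy.1.le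
    simp only [hu0, Real.zero_rpow h1β.ne'] at h5
    simp at h5
    linarith
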